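/- arXiv:2301.05953 — 6 statements merged into one kernel-verified Lean document; each statement's English description precedes it below -/
import Mathlib

section
/- Higher order singular value decomposition exists: for every Nth-order complex tensor ψ : (∀ n : Fin N, Fin (I n)) → ℂ there exist unitary matrices U^(1), …, U^(N) (with U^(n) of size I_n × I_n) and an Nth-order complex tensor T such that (i) ψ(i) = ∑ over all index tuples j of (∏_{n} U^(n)(i n, j n)) · T(j) for every index tuple i; (ii) all-orthogonality: for every mode n and every α ≠ β in Fin (I n), ∑ over all assignments of the remaining indices of conj(T(j with n-th index α)) · T(j with n-th index β) = 0; and (iii) ordering: for every mode n, the subtensor norms |T_{i_n = 1}| ≥ |T_{i_n = 2}| ≥ … ≥ |T_{i_n = I_n}| ≥ 0, where |T_{i_n = α}|² = ∑ over all assignments of the remaining indices of |T(j with n-th index α)|². -/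
open scoped ComplexConjugate Matrix

/-- Insert an index `k` at position `n` into a tuple `A` of the remaining indices,
producing a full index tuple. -/
def insertIdx {N : ℕ} {I : Fin N → ℕ} (n : Fin N) (k : Fin (I n))
    (A : ∀ m : {m : Fin N // m ≠ n}, Fin (I m.1)) : ∀ m : Fin N, Fin (I m) :=
  fun m => if h : m = n then (h.symm ▸ k) else A ⟨m, h⟩

section PiKronecker

variable {ι : Type*} [Fintype ι] {κ : ι → Type*}

/-- The Kronecker product of a finite family of square matrices. -/
def piKronecker (U : ∀ m, Matrix (κ m) (κ m) ℂ) : Matrix (∀ m, κ m) (∀ m, κ m) ℂ :=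
  Matrix.of fun i j => ∏ m, U m (i m) (j m)

theorem piKronecker_mul [DecidableEq ι] [∀ m, Fintype (κ m)]
    (U V : ∀ m, Matrix (κ m) (κ m) ℂ) :
    piKronecker U * piKronecker V = piKronecker fun m => U m * V m := by
  ext i j
  simp only [piKronecker, Matrix.mul_apply, Matrix.of_apply, Finset.prod_univ_sum,
    Fintype.piFinset_univ, Finset.prod_mul_distrib]

theorem piKronecker_one [∀ m, DecidableEq (κ m)] [DecidableEq (∀ m, κ m)] :
    piKronecker (fun m => (1 : Matrix (κ m) (κ m) ℂ)) = 1 := by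
  ext i j
  simp only [piKronecker, Matrix.of_apply, Matrix.one_apply, Finset.prod_ite_zero,
    Finset.prod_const_one, Finset.mem_univ, true_imp_iff, funext_iff]

theorem piKronecker_conjTranspose (U : ∀ m, Matrix (κ m) (κ m) ℂ) :
    (piKronecker U)ᴴ = piKronecker fun m => (U m)ᴴ := by
  ext i j
  simp [piKronecker, Matrix.conjTranspose_apply]

end PiKronecker

/-- A Hermitian matrix is unitarily diagonalizable with eigenvalues in decreasing order. -/
theorem Matrix.IsHermitian.exists_unitary_antitone_diagonal {k : ℕ}
    {A : Matrix (Fin k) (Fin k) ℂ} (hA : A.IsHermitian) :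
    ∃ (W : Matrix (Fin k) (Fin k) ℂ) (d : Fin k → ℝ), W * Wᴴ = 1 ∧ Antitone d ∧
      Wᴴ * A * W = Matrix.diagonal fun a => (d a : ℂ) := by
  let V : Matrix (Fin k) (Fin k) ℂ := hA.eigenvectorUnitary
  have hV : V * Vᴴ = 1 := Unitary.coe_mul_star_self hA.eigenvectorUnitary
  have hVA : Vᴴ * A * V = Matrix.diagonal fun a => (hA.eigenvalues a : ℂ) := by
    have h := hA.conjStarAlgAut_star_eigenvectorUnitary
    rw [Unitary.conjStarAlgAut_star_apply] at h
    exact h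
  let σ := Tuple.sort fun a => -hA.eigenvalues a
  refine ⟨V.submatrix id σ, hA.eigenvalues ∘ σ, ?_, ?_, ?_⟩
  · rw [Matrix.conjTranspose_submatrix, Matrix.submatrix_mul_equiv, hV, Matrix.submatrix_id_id]
  · intro a b hab
    exact neg_le_neg_iff.mp (Tuple.monotone_sort (fun a => -hA.eigenvalues a) hab)
  · have h : (V.submatrix id σ)ᴴ * A * V.submatrix id σ = (Vᴴ * A * V).submatrix σ σ := by
      ext i j
      simp [Matrix.mul_apply]
    rw [h, hVA, Matrix.submatrix_diagonal_equiv]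
    rfl

section Unfolding

variable {N : ℕ} {I : Fin N → ℕ}

theorem insertIdx_self (n : Fin N) (k : Fin (I n))
    (A : ∀ m : {m : Fin N // m ≠ n}, Fin (I m.1)) : insertIdx n k A n = k := by
  simp [insertIdx]

theorem insertIdx_coe (n : Fin N) (k : Fin (I n))
    (A : ∀ m : {m : Fin N // m ≠ n}, Fin (I m.1)) (m : {m : Fin N // m ≠ n}) :
    insertIdx n k A m.1 = A m := by
  simp [insertIdx, m.2]

theorem sum_eq_sum_insertIdx (n : Fin N) (f : (∀ m, Fin (I m)) → ℂ) :
    ∑ j, f j = ∑ k, ∑ A, f (insertIdx n k A) := by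
  rw [← (Equiv.piSplitAt n fun m => Fin (I m)).symm.sum_comp, Fintype.sum_prod_type]
  rfl

/-- The mode-`n` matrix unfolding of a tensor. -/
def modeUnfolding (n : Fin N) (T : (∀ m, Fin (I m)) → ℂ) :
    Matrix (Fin (I n)) (∀ m : {m : Fin N // m ≠ n}, Fin (I m.1)) ℂ :=
  Matrix.of fun k A => T (insertIdx n k A)

theorem modeUnfolding_piKronecker_mulVec (n : Fin N) (U : ∀ m, Matrix (Fin (I m)) (Fin (I m)) ℂ)
    (T : (∀ m, Fin (I m)) → ℂ) :
    modeUnfolding n (piKronecker U *ᵥ T) =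
      U n * modeUnfolding n T * (piKronecker fun m : {m : Fin N // m ≠ n} => U m.1)ᵀ := by
  ext k A
  simp only [modeUnfolding, piKronecker, Matrix.of_apply, Matrix.mulVec, dotProduct, Matrix.mul_apply,
    Matrix.transpose_apply, Finset.sum_mul]
  rw [sum_eq_sum_insertIdx n, Finset.sum_comm]
  refine Finset.sum_congr rfl fun B _ => Finset.sum_congr rfl fun l _ => ?_
  rw [Fintype.prod_eq_mul_prod_subtype_ne _ n]
  simp only [insertIdx_self, insertIdx_coe]
  ring

/-- Unitary factors act on the mode-`n` Gram matrix through the `n`-th factor only. -/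
theorem modeUnfolding_piKronecker_mulVec_gram (n : Fin N)
    (U : ∀ m, Matrix (Fin (I m)) (Fin (I m)) ℂ) (hU : ∀ m, (U m)ᴴ * U m = 1)
    (T : (∀ m, Fin (I m)) → ℂ) :
    modeUnfolding n (piKronecker U *ᵥ T) * (modeUnfolding n (piKronecker U *ᵥ T))ᴴ =
      U n * (modeUnfolding n T * (modeUnfolding n T)ᴴ) * (U n)ᴴ := by
  rw [modeUnfolding_piKronecker_mulVec]
  set K := piKronecker fun m : {m : Fin N // m ≠ n} => U m.1 with hK
  have hKK : Kᵀ * Kᵀᴴ = 1 := by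
    have h : Kᴴ * K = 1 := by
      simp only [hK, piKronecker_conjTranspose, piKronecker_mul, hU, piKronecker_one]
    rw [show Kᵀᴴ = Kᴴᵀ from rfl, ← Matrix.transpose_mul, h, Matrix.transpose_one]
  rw [Matrix.conjTranspose_mul, Matrix.conjTranspose_mul, Matrix.mul_assoc _ Kᵀ,
    ← Matrix.mul_assoc Kᵀ, hKK, Matrix.one_mul]
  simp only [Matrix.mul_assoc]

end Unfolding

/-- existence of the higher order singular value decomposition
(HOSVD): unitary factors `U^(n)` and a core tensor `T` satisfying the
decomposition, all-orthogonality and ordering properties. -/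
theorem exists_hosvd {N : ℕ} {I : Fin N → ℕ} (ψ : (∀ n : Fin N, Fin (I n)) → ℂ) :
    ∃ (U : ∀ n : Fin N, Matrix (Fin (I n)) (Fin (I n)) ℂ)
      (T : (∀ n : Fin N, Fin (I n)) → ℂ),
      -- each `U^(n)` is unitary
      (∀ n : Fin N, U n * (U n)ᴴ = 1) ∧
      -- (i) the decomposition `Ψ = U^(1) ⊗ ⋯ ⊗ U^(N) 𝓣`
      (∀ i : ∀ n : Fin N, Fin (I n),
        ψ i = ∑ j : ∀ n : Fin N, Fin (I n), (∏ n : Fin N, U n (i n) (j n)) * T j) ∧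
      -- (ii) all-orthogonality of the core tensor
      (∀ n : Fin N, ∀ α β : Fin (I n), α ≠ β →
        ∑ A : ∀ m : {m : Fin N // m ≠ n}, Fin (I m.1),
          conj (T (insertIdx n α A)) * T (insertIdx n β A) = 0) ∧
      -- (iii) ordering of the subtensor norms
      (∀ n : Fin N, ∀ α β : Fin (I n), α ≤ β →
        ∑ A : ∀ m : {m : Fin N // m ≠ n}, Fin (I m.1), ‖T (insertIdx n β A)‖ ^ 2 ≤
          ∑ A : ∀ m : {m : Fin N // m ≠ n}, Fin (I m.1), ‖T (insertIdx n α A)‖ ^ 2) := by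
  choose W d hW hd hWd using fun n : Fin N =>
    (Matrix.isHermitian_mul_conjTranspose_self (modeUnfolding n ψ)).exists_unitary_antitone_diagonal
  let T := piKronecker (fun n => (W n)ᴴ) *ᵥ ψ
  have hgram (n : Fin N) :
      modeUnfolding n T * (modeUnfolding n T)ᴴ = Matrix.diagonal fun a => (d n a : ℂ) := by
    rw [modeUnfolding_piKronecker_mulVec_gram n _ (by simpa using hW), Matrix.conjTranspose_conjTranspose,
      hWd]
  have hentry (n : Fin N) (α β : Fin (I n)) :
      ∑ A, conj (T (insertIdx n α A)) * T (insertIdx n β A) =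
        Matrix.diagonal (fun a => (d n a : ℂ)) β α := by
    rw [← hgram, Matrix.mul_apply]
    exact Finset.sum_congr rfl fun A _ => mul_comm _ _
  have hnorm (n : Fin N) (α : Fin (I n)) : ∑ A, ‖T (insertIdx n α A)‖ ^ 2 = d n α := by
    have h := hentry n α α
    simp only [Complex.conj_mul', Matrix.diagonal_apply_eq] at h
    exact_mod_cast h
  refine ⟨W, T, hW, fun i => ?_, fun n α β hαβ => ?_, fun n α β hαβ => ?_⟩
  · have h : piKronecker W *ᵥ T = ψ := by
      simp only [T, Matrix.mulVec_mulVec, piKronecker_mul, hW, piKronecker_one, Matrix.one_mulVec]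
    exact (congrFun h i).symm
  · rw [hentry, Matrix.diagonal_apply_ne _ hαβ.symm]
  · rw [hnorm, hnorm]
    exact hd n hαβ
end

section
/- If a three-qubit tensor t satisfies the three all-orthogonality conditions, then the determinant of the 3×3 complex matrix with rows (t_{211}, conj(t_{122}), conj(t_{121}) t_{221} + conj(t_{112}) t_{212}), (t_{121}, conj(t_{212}), conj(t_{211}) t_{221} + conj(t_{112}) t_{122}), (t_{112}, conj(t_{221}), conj(t_{211}) t_{212} + conj(t_{121}) t_{122}) equals 0. -/
open scoped ComplexConjugate Matrix

/-- A three-qubit tensor `t` (index `0` stands for `1` and index `1` for `2`)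
satisfies the three all-orthogonality conditions. -/
def ThreeQubitAllOrtho (t : Fin 2 → Fin 2 → Fin 2 → ℂ) : Prop :=
  -- (1): conj(t₁₁₁)t₂₁₁ + conj(t₁₂₁)t₂₂₁ + conj(t₁₁₂)t₂₁₂ + conj(t₁₂₂)t₂₂₂ = 0
  (conj (t 0 0 0) * t 1 0 0 + conj (t 0 1 0) * t 1 1 0 +
    conj (t 0 0 1) * t 1 0 1 + conj (t 0 1 1) * t 1 1 1 = 0) ∧
  -- (2): conj(t₁₁₁)t₁₂₁ + conj(t₂₁₁)t₂₂₁ + conj(t₁₁₂)t₁₂₂ + conj(t₂₁₂)t₂₂₂ = 0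
  (conj (t 0 0 0) * t 0 1 0 + conj (t 1 0 0) * t 1 1 0 +
    conj (t 0 0 1) * t 0 1 1 + conj (t 1 0 1) * t 1 1 1 = 0) ∧
  -- (3): conj(t₁₁₁)t₁₁₂ + conj(t₂₁₁)t₂₁₂ + conj(t₁₂₁)t₁₂₂ + conj(t₂₂₁)t₂₂₂ = 0
  (conj (t 0 0 0) * t 0 0 1 + conj (t 1 0 0) * t 1 0 1 +
    conj (t 0 1 0) * t 0 1 1 + conj (t 1 1 0) * t 1 1 1 = 0)

/-- the all-orthogonality conditions of three qubits imply the
concurrency-of-three-lines determinant vanishes. -/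
theorem concurrency_det_of_allOrtho (t : Fin 2 → Fin 2 → Fin 2 → ℂ)
    (h : ThreeQubitAllOrtho t) :
    Matrix.det
      !![t 1 0 0, conj (t 0 1 1), conj (t 0 1 0) * t 1 1 0 + conj (t 0 0 1) * t 1 0 1;
         t 0 1 0, conj (t 1 0 1), conj (t 1 0 0) * t 1 1 0 + conj (t 0 0 1) * t 0 1 1;
         t 0 0 1, conj (t 1 1 0), conj (t 1 0 0) * t 1 0 1 + conj (t 0 1 0) * t 0 1 1] = 0 := by
  obtain ⟨h₁, h₂, h₃⟩ := h
  -- The vector `(conj t₁₁₁, t₂₂₂, 1)` lies in the kernel of the matrix.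
  refine Matrix.exists_mulVec_eq_zero_iff.mp ⟨![conj (t 0 0 0), t 1 1 1, 1], ?_, ?_⟩
  · intro hv
    simpa using congrFun hv 2
  · ext i
    fin_cases i
    · simp [Matrix.mulVec, dotProduct, Fin.sum_univ_three]
      linear_combination h₁
    · simp [Matrix.mulVec, dotProduct, Fin.sum_univ_three]
      linear_combination h₂
    · simp [Matrix.mulVec, dotProduct, Fin.sum_univ_three]
      linear_combination h₃
end

section
/- If a three-qubit tensor t satisfies the three all-orthogonality conditions, then |t_{112}|² (|t_{122}|² − |t_{212}|²) + |t_{121}|² (|t_{221}|² − |t_{122}|²) + |t_{211}|² (|t_{212}|² − |t_{221}|²) = 0. -/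
open scoped ComplexConjugate Matrix

/-- the all-orthogonality conditions imply
`|t₁₁₂|²(|t₁₂₂|² − |t₂₁₂|²) + |t₁₂₁|²(|t₂₂₁|² − |t₁₂₂|²) + |t₂₁₁|²(|t₂₁₂|² − |t₂₂₁|²) = 0`. -/
theorem normSq_relation_of_allOrtho (t : Fin 2 → Fin 2 → Fin 2 → ℂ)
    (h : ThreeQubitAllOrtho t) :
    Complex.normSq (t 0 0 1) * (Complex.normSq (t 0 1 1) - Complex.normSq (t 1 0 1)) +
      Complex.normSq (t 0 1 0) * (Complex.normSq (t 1 1 0) - Complex.normSq (t 0 1 1)) +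
      Complex.normSq (t 1 0 0) * (Complex.normSq (t 1 0 1) - Complex.normSq (t 1 1 0)) = 0 := by
  obtain ⟨h₁, h₂, h₃⟩ := h
  have c₁ := congrArg conj h₁
  have c₂ := congrArg conj h₂
  have c₃ := congrArg conj h₃
  simp only [map_add, map_mul, Complex.conj_conj, map_zero] at c₁ c₂ c₃
  apply Complex.ofReal_injective
  push_cast
  simp only [Complex.normSq_eq_conj_mul_self]
  -- Eliminating `t 0 0 0` and `t 1 1 1` leaves the claim plus a purely imaginary term,
  -- which averaging with the complex conjugate removes.
  linear_combination
    (1 / 2) * ((t 0 1 0 * conj (t 1 1 0) - t 0 0 1 * conj (t 1 0 1)) * h₁ +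
      (t 0 0 1 * conj (t 0 1 1) - t 1 0 0 * conj (t 1 1 0)) * h₂ +
      (t 1 0 0 * conj (t 1 0 1) - t 0 1 0 * conj (t 0 1 1)) * h₃ +
      (conj (t 0 1 0) * t 1 1 0 - conj (t 0 0 1) * t 1 0 1) * c₁ +
      (conj (t 0 0 1) * t 0 1 1 - conj (t 1 0 0) * t 1 1 0) * c₂ +
      (conj (t 1 0 0) * t 1 0 1 - conj (t 0 1 0) * t 0 1 1) * c₃)
end

section
/- If a three-qubit tensor t satisfies the three all-orthogonality conditions, then conj(t_{112}) conj(t_{221}) (t_{122} t_{211} − t_{121} t_{212}) + conj(t_{121}) conj(t_{212}) (t_{112} t_{221} − t_{122} t_{211}) + conj(t_{122}) conj(t_{211}) (t_{121} t_{212} − t_{112} t_{221}) = 0. -/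
open scoped ComplexConjugate Matrix

/-- the all-orthogonality conditions imply the phase relation
`conj(t₁₁₂)conj(t₂₂₁)(t₁₂₂t₂₁₁ − t₁₂₁t₂₁₂) + conj(t₁₂₁)conj(t₂₁₂)(t₁₁₂t₂₂₁ − t₁₂₂t₂₁₁)
 + conj(t₁₂₂)conj(t₂₁₁)(t₁₂₁t₂₁₂ − t₁₁₂t₂₂₁) = 0`. -/
theorem phase_relation_of_allOrtho (t : Fin 2 → Fin 2 → Fin 2 → ℂ)
    (h : ThreeQubitAllOrtho t) :
    conj (t 0 0 1) * conj (t 1 1 0) * (t 0 1 1 * t 1 0 0 - t 0 1 0 * t 1 0 1) +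
      conj (t 0 1 0) * conj (t 1 0 1) * (t 0 0 1 * t 1 1 0 - t 0 1 1 * t 1 0 0) +
      conj (t 0 1 1) * conj (t 1 0 0) * (t 0 1 0 * t 1 0 1 - t 0 0 1 * t 1 1 0) = 0 := by
  obtain ⟨h₁, h₂, h₃⟩ := h
  have hconj₁ := congrArg conj h₁
  have hconj₂ := congrArg conj h₂
  have hconj₃ := congrArg conj h₃
  simp only [map_add, map_mul, Complex.conj_conj, map_zero] at hconj₁ hconj₂ hconj₃
  -- The determinant combination of the three conditions eliminates `t 0 0 0` and `t 1 1 1`;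
  -- subtracting its conjugate cancels the real terms, and the phase expression is imaginary.
  linear_combination
    -(1 / 2) * ((t 0 1 0 * conj (t 1 1 0) - t 0 0 1 * conj (t 1 0 1)) * h₁ +
      (t 0 0 1 * conj (t 0 1 1) - t 1 0 0 * conj (t 1 1 0)) * h₂ +
      (t 1 0 0 * conj (t 1 0 1) - t 0 1 0 * conj (t 0 1 1)) * h₃) +
    (1 / 2) * ((conj (t 0 1 0) * t 1 1 0 - conj (t 0 0 1) * t 1 0 1) * hconj₁ +
      (conj (t 0 0 1) * t 0 1 1 - conj (t 1 0 0) * t 1 1 0) * hconj₂ +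
      (conj (t 1 0 0) * t 1 0 1 - conj (t 0 1 0) * t 0 1 1) * hconj₃)
end

section
/- If a three-qubit tensor t satisfies the three all-orthogonality conditions, then |t_{112}|² (σ₁^(1)2 − σ₁^(2)2) + |t_{211}|² (σ₁^(2)2 − σ₁^(3)2) + |t_{121}|² (σ₁^(3)2 − σ₁^(1)2) = 0, where σ₁^(n)2 denotes the squared first n-mode singular value of t. -/
open scoped ComplexConjugate Matrix

/-- the all-orthogonality conditions imply
`|t₁₁₂|²(σ₁⁽¹⁾² − σ₁⁽²⁾²) + |t₂₁₁|²(σ₁⁽²⁾² − σ₁⁽³⁾²) + |t₁₂₁|²(σ₁⁽³⁾² − σ₁⁽¹⁾²) = 0`,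
where `σ₁⁽ⁿ⁾²` is the squared first `n`-mode singular value of `t`. -/
theorem singular_value_relation_of_allOrtho (t : Fin 2 → Fin 2 → Fin 2 → ℂ)
    (h : ThreeQubitAllOrtho t) :
    -- σ₁⁽¹⁾² = |t₁₁₁|² + |t₁₁₂|² + |t₁₂₁|² + |t₁₂₂|²
    -- σ₁⁽²⁾² = |t₁₁₁|² + |t₁₁₂|² + |t₂₁₁|² + |t₂₁₂|²
    -- σ₁⁽³⁾² = |t₁₁₁|² + |t₁₂₁|² + |t₂₁₁|² + |t₂₂₁|²
    Complex.normSq (t 0 0 1) *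
        ((Complex.normSq (t 0 0 0) + Complex.normSq (t 0 0 1) +
            Complex.normSq (t 0 1 0) + Complex.normSq (t 0 1 1)) -
          (Complex.normSq (t 0 0 0) + Complex.normSq (t 0 0 1) +
            Complex.normSq (t 1 0 0) + Complex.normSq (t 1 0 1))) +
      Complex.normSq (t 1 0 0) *
        ((Complex.normSq (t 0 0 0) + Complex.normSq (t 0 0 1) +
            Complex.normSq (t 1 0 0) + Complex.normSq (t 1 0 1)) -
          (Complex.normSq (t 0 0 0) + Complex.normSq (t 0 1 0) +
            Complex.normSq (t 1 0 0) + Complex.normSq (t 1 1 0))) +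
      Complex.normSq (t 0 1 0) *
        ((Complex.normSq (t 0 0 0) + Complex.normSq (t 0 1 0) +
            Complex.normSq (t 1 0 0) + Complex.normSq (t 1 1 0)) -
          (Complex.normSq (t 0 0 0) + Complex.normSq (t 0 0 1) +
            Complex.normSq (t 0 1 0) + Complex.normSq (t 0 1 1))) = 0 := by
  obtain ⟨h₁, h₂, h₃⟩ := h
  have h₁c := congrArg conj h₁
  have h₂c := congrArg conj h₂
  have h₃c := congrArg conj h₃
  simp only [map_add, map_mul, Complex.conj_conj, map_zero] at h₁c h₂c h₃c
  apply Complex.ofReal_injective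
  push_cast
  simp only [Complex.normSq_eq_conj_mul_self]
  -- Eliminating `t 0 0 0` and `t 1 1 1` leaves the claim plus a purely imaginary term,
  -- which cancels against its conjugate.
  linear_combination
    (1 / 2) * (conj (t 1 1 0) * t 0 1 0 - conj (t 1 0 1) * t 0 0 1) * h₁ +
    (1 / 2) * (conj (t 0 1 1) * t 0 0 1 - conj (t 1 1 0) * t 1 0 0) * h₂ +
    (1 / 2) * (conj (t 1 0 1) * t 1 0 0 - conj (t 0 1 1) * t 0 1 0) * h₃ +
    (1 / 2) * (t 1 1 0 * conj (t 0 1 0) - t 1 0 1 * conj (t 0 0 1)) * h₁c +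
    (1 / 2) * (t 0 1 1 * conj (t 0 0 1) - t 1 1 0 * conj (t 1 0 0)) * h₂c +
    (1 / 2) * (t 1 0 1 * conj (t 1 0 0) - t 0 1 1 * conj (t 0 1 0)) * h₃c
end

section
/- If a three-qubit tensor t satisfies the three all-orthogonality conditions and t_{212} conj(t_{211}) − t_{122} conj(t_{121}) ≠ 0, then t_{111} = −(conj(t_{221}) (t_{121} t_{212} − t_{122} t_{211}) + t_{112} (|t_{212}|² − |t_{122}|²)) / (t_{212} conj(t_{211}) − t_{122} conj(t_{121})) and t_{222} = (conj(t_{112}) (t_{121} t_{212} − t_{122} t_{211}) + t_{221} (|t_{121}|² − |t_{211}|²)) / (conj(t_{212}) t_{211} − conj(t_{122}) t_{121}). -/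
open scoped ComplexConjugate Matrix

/-- solving the all-orthogonality conditions for `t₁₁₁` and `t₂₂₂`
when `t₂₁₂ conj(t₂₁₁) − t₁₂₂ conj(t₁₂₁) ≠ 0`. -/
theorem solve_t111_t222_of_allOrtho (t : Fin 2 → Fin 2 → Fin 2 → ℂ)
    (h : ThreeQubitAllOrtho t)
    (hden : t 1 0 1 * conj (t 1 0 0) - t 0 1 1 * conj (t 0 1 0) ≠ 0) :
    t 0 0 0 =
      -((conj (t 1 1 0) * (t 0 1 0 * t 1 0 1 - t 0 1 1 * t 1 0 0) +
          t 0 0 1 * ((Complex.normSq (t 1 0 1) : ℂ) - (Complex.normSq (t 0 1 1) : ℂ))) /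
        (t 1 0 1 * conj (t 1 0 0) - t 0 1 1 * conj (t 0 1 0))) ∧
    t 1 1 1 =
      (conj (t 0 0 1) * (t 0 1 0 * t 1 0 1 - t 0 1 1 * t 1 0 0) +
          t 1 1 0 * ((Complex.normSq (t 0 1 0) : ℂ) - (Complex.normSq (t 1 0 0) : ℂ))) /
        (conj (t 1 0 1) * t 1 0 0 - conj (t 0 1 1) * t 0 1 0) := by
  obtain ⟨h1, h2, -⟩ := h
  have hden' : conj (t 1 0 1) * t 1 0 0 - conj (t 0 1 1) * t 0 1 0 ≠ 0 := by
    intro h0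
    apply hden
    simpa using congrArg conj h0
  constructor
  · have h1c := congrArg conj h1
    have h2c := congrArg conj h2
    simp only [map_add, map_mul, Complex.conj_conj, map_zero] at h1c h2c
    rw [← neg_div, eq_div_iff hden, ← Complex.mul_conj, ← Complex.mul_conj]
    linear_combination t 1 0 1 * h1c - t 0 1 1 * h2c
  · rw [eq_div_iff hden', ← Complex.mul_conj, ← Complex.mul_conj]
    linear_combination t 1 0 0 * h2 - t 0 1 0 * h1
end
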